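/- Let q be any prime power and F = GF(q). Let L be a 2-dimensional F-subspace of F^6, and let r be the number of 1-dimensional subspaces ⟨y⟩ of L with rank(M_y) ≤ 2 (the number of points of the corresponding projective line lying on the secant variety of the Veronese surface). Let W_L = {a ∈ F^6 : B(a,y) = 0 for all y ∈ L} be the associated web of conics (a 4-dimensional subspace). Then r ∈ {0,1,2,3,q+1}, the number of 1-dimensional subspaces ⟨a⟩ of W_L with Δ(a) = 0 (singular conics of the web) equals q^2 + r·q + 1, and consequently the number of nonsingular conics of W_L equals q^3 + (1−r)·q. -/

import Mathlib

open Matrix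

namespace Conics

/-- Coefficient vector (a0,...,a5) of the product of two linear forms
`(b0*X0+b1*X1+b2*X2)*(c0*X0+c1*X1+c2*X2)`, where the quadratic form with
coefficient vector `a` is `a0*X0^2 + a1*X0*X1 + a2*X0*X2 + a3*X1^2 + a4*X1*X2 + a5*X2^2`. -/
def mulLin {F : Type} [Field F] (b c : Fin 3 → F) : Fin 6 → F :=
  ![b 0 * c 0, b 0 * c 1 + b 1 * c 0, b 0 * c 2 + b 2 * c 0,
    b 1 * c 1, b 1 * c 2 + b 2 * c 1, b 2 * c 2]

/-- The discriminant of the quadratic form with coefficient vector `a`. -/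
def disc {F : Type} [Field F] (a : Fin 6 → F) : F :=
  4 * a 0 * a 3 * a 5 + a 1 * a 2 * a 4 - a 0 * a 4 ^ 2 - a 3 * a 2 ^ 2 - a 5 * a 1 ^ 2

/-- `f_a` is a double line: `f_a = c * l^2` for a nonzero scalar `c` and nonzero linear form `l`. -/
def IsDoubleLine {F : Type} [Field F] (a : Fin 6 → F) : Prop :=
  ∃ (c : F) (l : Fin 3 → F), c ≠ 0 ∧ l ≠ 0 ∧ a = c • mulLin l l

/-- `f_a` is a pair of (distinct) real lines: `f_a = l1 * l2` with neither linear form a scalar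
multiple of the other. -/
def IsRealPair {F : Type} [Field F] (a : Fin 6 → F) : Prop :=
  ∃ l1 l2 : Fin 3 → F, (¬ ∃ t : F, l2 = t • l1) ∧ (¬ ∃ t : F, l1 = t • l2) ∧ a = mulLin l1 l2

/-- `f_a` is a pair of conjugate imaginary lines: singular, but not a product of two linear
forms over `F`. -/
def IsImagPair {F : Type} [Field F] (a : Fin 6 → F) : Prop :=
  disc a = 0 ∧ ¬ ∃ l1 l2 : Fin 3 → F, a = mulLin l1 l2

/-- `f_a` is a nonsingular conic. -/
def IsNonsingular {F : Type} [Field F] (a : Fin 6 → F) : Prop :=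
  disc a ≠ 0

/-- The number of conics of a given type `T` in a linear system `W` (a subspace of the space of
quadratic forms, identified with `F^6`): the number of 1-dimensional subspaces `⟨a⟩` of `W`,
`a ≠ 0`, such that `f_a` has type `T`. -/
noncomputable def numConics {F : Type} [Field F] (W : Submodule F (Fin 6 → F))
    (T : (Fin 6 → F) → Prop) : ℕ :=
  Set.ncard {P : Submodule F (Fin 6 → F) |
    ∃ a : Fin 6 → F, a ≠ 0 ∧ a ∈ W ∧ T a ∧ P = Submodule.span F {a}}

/-- The symmetric 3×3 matrix associated with a point `y` of `PG(5,q)`. -/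
def M {F : Type} [Field F] (y : Fin 6 → F) : Matrix (Fin 3) (Fin 3) F :=
  !![y 0, y 1, y 2; y 1, y 3, y 4; y 2, y 4, y 5]

/-- The pairing `B(a,y) = a0*y0 + ... + a5*y5`. -/
def Bform {F : Type} [Field F] (a y : Fin 6 → F) : F :=
  a 0 * y 0 + a 1 * y 1 + a 2 * y 2 + a 3 * y 3 + a 4 * y 4 + a 5 * y 5

/-- The squab of conics associated with a (nonzero) point `y`: the hyperplane
`{a : B(a,y) = 0}` of the space of quadratic forms. -/
def squab {F : Type} [Field F] (y : Fin 6 → F) : Submodule F (Fin 6 → F) where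
  carrier := {a | Bform a y = 0}
  add_mem' := by
    intro a b ha hb
    simp only [Set.mem_setOf_eq, Bform, Pi.add_apply] at *
    linear_combination ha + hb
  zero_mem' := by simp [Bform]
  smul_mem' := by
    intro c a ha
    simp only [Set.mem_setOf_eq, Bform, Pi.smul_apply, smul_eq_mul] at *
    linear_combination c * ha

/-- The linear system `{a : B(a,y) = 0 for all y ∈ L}` associated with a subspace `L` of the
ambient space of the Veronese surface. -/
def perp {F : Type} [Field F] (L : Submodule F (Fin 6 → F)) : Submodule F (Fin 6 → F) where
  carrier := {a | ∀ y ∈ L, Bform a y = 0}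
  add_mem' := by
    intro a b ha hb y hy
    have h1 := ha y hy
    have h2 := hb y hy
    simp only [Bform, Pi.add_apply]
    simp only [Bform] at h1 h2
    linear_combination h1 + h2
  zero_mem' := by intro y hy; simp [Bform]
  smul_mem' := by
    intro c a ha y hy
    have h := ha y hy
    simp only [Bform, Pi.smul_apply, smul_eq_mul]
    simp only [Bform] at h
    linear_combination c * h


section Counting

set_option linter.unusedSectionVars false

variable {F : Type} [Field F] [Fintype F]

open Classical in
/-- number of singular forms in the hyperplane orthogonal to `y` (as vectors). -/
noncomputable def cnt (y : Fin 6 → F) : ℕ :=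
  ∑ a : Fin 6 → F, if disc a = 0 ∧ Bform a y = 0 then 1 else 0

theorem sum6 (f : (Fin 6 → F) → ℕ) :
    ∑ a, f a = ∑ a3 : F, ∑ a4 : F, ∑ a5 : F, ∑ a2 : F, ∑ a1 : F, ∑ a0 : F,
      f ![a0, a1, a2, a3, a4, a5] := by
  let e : (F × F × F × F × F × F) ≃ (Fin 6 → F) :=
    { toFun := fun p => ![p.2.2.2.2.2, p.2.2.2.2.1, p.2.2.2.1, p.1, p.2.1, p.2.2.1]
      invFun := fun a => (a 3, a 4, a 5, a 2, a 1, a 0)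
      left_inv := fun p => by simp
      right_inv := fun a => by
        ext i
        fin_cases i <;> simp }
  rw [← e.sum_comp]
  simp only [Fintype.sum_prod_type]
  rfl

theorem exists_beta (a b c : F) (ha : a ≠ 0) (h : 4 * a * c = b ^ 2) :
    ∃ β : F, b = 2 * a * β ∧ c = a * β ^ 2 := by
  by_cases h2 : (2 : F) = 0
  · have hb : b = 0 := by
      have : b ^ 2 = 0 := by rw [← h]; linear_combination 2 * a * c * h2
      exact pow_eq_zero_iff (two_ne_zero) |>.1 this
    have hc : ringChar F = 2 := by
      have hd : ringChar F ∣ 2 := (ringChar.spec F 2).1 (by exact_mod_cast h2)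
      rcases (Nat.dvd_prime Nat.prime_two).1 hd with h1 | h1
      · exact absurd h1 (CharP.ringChar_ne_one)
      · exact h1
    obtain ⟨β, hβ⟩ := FiniteField.isSquare_of_char_two hc (c / a)
    refine ⟨β, by rw [hb]; linear_combination - a * β * h2, ?_⟩
    field_simp at hβ
    linear_combination hβ
  · refine ⟨b / (2 * a), by field_simp, ?_⟩
    field_simp
    linear_combination h

theorem beta_iff {a b c : F} (ha : a ≠ 0) (h : 4 * a * c = b ^ 2) :
    ∃ β : F, ∀ x z : F, a * x ^ 2 - b * z * x + c * z ^ 2 = 0 ↔ x = β * z := by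
  obtain ⟨β, rfl, rfl⟩ := exists_beta a b c ha h
  refine ⟨β, fun x z => ?_⟩
  have : a * x ^ 2 - 2 * a * β * z * x + a * β ^ 2 * z ^ 2 = a * (x - β * z) ^ 2 := by ring
  rw [this]
  simp [ha, sub_eq_zero]

open Classical in
theorem sum_a0 {D c : F} (hD : D ≠ 0) : (∑ x : F, if x * D = c then 1 else 0) = (1 : ℕ) := by
  have : ∀ x : F, x * D = c ↔ x = c / D := fun x => by rw [eq_div_iff hD]
  simp [this]

/-- the affine discriminant relation -/
theorem disc_vec (a0 a1 a2 a3 a4 a5 : F) :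
    disc ![a0, a1, a2, a3, a4, a5] = 0 ↔
      a0 * (4 * a3 * a5 - a4 ^ 2) = a3 * a2 ^ 2 - a4 * a1 * a2 + a5 * a1 ^ 2 := by
  simp only [disc, Matrix.cons_val]
  constructor <;> intro h <;> linear_combination h

open Classical in
theorem inner1 (a3 a4 a5 : F) (h : ¬ (a3 = 0 ∧ a4 = 0 ∧ a5 = 0)) :
    (∑ a2 : F, ∑ a1 : F, ∑ a0 : F,
      if disc ![a0, a1, a2, a3, a4, a5] = 0 then 1 else 0) = Fintype.card F ^ 2 := by
  simp only [disc_vec]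
  by_cases hD : 4 * a3 * a5 - a4 ^ 2 = 0
  · simp only [hD, mul_zero]
    by_cases h3 : a3 = 0
    · have h4 : a4 = 0 := by
        have : a4 ^ 2 = 0 := by rw [h3] at hD; linear_combination -hD
        exact pow_eq_zero_iff (two_ne_zero) |>.1 this
      have h5 : a5 ≠ 0 := fun h5 => h ⟨h3, h4, h5⟩
      simp [h3, h4, h5, sq]
    · obtain ⟨β, hβ⟩ := beta_iff h3 (sub_eq_zero.1 hD)
      rw [Finset.sum_comm]
      have : ∀ a1 a2 : F, (0 = a3 * a2 ^ 2 - a4 * a1 * a2 + a5 * a1 ^ 2) ↔ a2 = β * a1 :=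
        fun a1 a2 => by rw [eq_comm, hβ]
      simp [this]
      ring
  · simp only [sum_a0 hD]
    simp [sq]

open Classical in
theorem inner0 :
    (∑ a2 : F, ∑ a1 : F, ∑ a0 : F,
      if disc ![a0, a1, a2, (0:F), 0, 0] = 0 then 1 else 0) = Fintype.card F ^ 3 := by
  simp only [disc_vec]
  simp
  ring

open Classical in
/-- number of `g` in a hyperplane of binary forms -/
noncomputable def gcnt (y3 y4 y5 : F) : ℕ :=
  ∑ a3 : F, ∑ a4 : F, ∑ a5 : F, if a3 * y3 + a4 * y4 + a5 * y5 = 0 then 1 else 0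

theorem cnt_case0 (y3 y4 y5 : F) :
    cnt ![0, 0, 0, y3, y4, y5] + Fintype.card F ^ 2
      = Fintype.card F ^ 2 * gcnt y3 y4 y5 + Fintype.card F ^ 3 := by
  classical
  set q := Fintype.card F with hq
  have key : ∀ a3 a4 a5 : F,
      (∑ a2 : F, ∑ a1 : F, ∑ a0 : F,
        if disc ![a0, a1, a2, a3, a4, a5] = 0 ∧
          Bform ![a0, a1, a2, a3, a4, a5] ![0, 0, 0, y3, y4, y5] = 0 then 1 else 0)
        + (if a3 = 0 then if a4 = 0 then if a5 = 0 then q ^ 2 else 0 else 0 else 0)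
      = q ^ 2 * (if a3 * y3 + a4 * y4 + a5 * y5 = 0 then 1 else 0)
        + (if a3 = 0 then if a4 = 0 then if a5 = 0 then q ^ 3 else 0 else 0 else 0) := by
    intro a3 a4 a5
    have hB : ∀ a0 a1 a2 : F, Bform ![a0, a1, a2, a3, a4, a5] ![0, 0, 0, y3, y4, y5]
        = a3 * y3 + a4 * y4 + a5 * y5 := by
      intro a0 a1 a2
      simp [Bform]
    simp only [hB]
    by_cases h0 : a3 = 0 ∧ a4 = 0 ∧ a5 = 0
    · obtain ⟨rfl, rfl, rfl⟩ := h0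
      simp only [zero_mul, add_zero, and_true, if_true]
      rw [inner0]; ring
    · have h0' : ∀ n : ℕ,
          (if a3 = 0 then if a4 = 0 then if a5 = 0 then n else 0 else 0 else 0) = 0 := by
        intro n
        split_ifs <;> tauto
      rw [h0', h0']
      by_cases hg : a3 * y3 + a4 * y4 + a5 * y5 = 0
      · simp only [hg, and_true, if_true]
        rw [inner1 _ _ _ h0]; simp [hq]
      · simp [hg]
  unfold cnt gcnt
  rw [sum6]
  have := Finset.sum_congr (rfl : (Finset.univ : Finset F) = Finset.univ) fun a3 _ =>
    Finset.sum_congr (rfl : (Finset.univ : Finset F) = Finset.univ) fun a4 _ =>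
    Finset.sum_congr (rfl : (Finset.univ : Finset F) = Finset.univ) fun a5 _ => key a3 a4 a5
  simp only [Finset.sum_add_distrib, ← Finset.mul_sum] at this
  simpa using this

theorem gcnt_zero : gcnt (0 : F) 0 0 = Fintype.card F ^ 3 := by
  simp [gcnt]; ring

theorem gcnt_ne (y3 y4 y5 : F) (h : ¬ (y3 = 0 ∧ y4 = 0 ∧ y5 = 0)) :
    gcnt y3 y4 y5 = Fintype.card F ^ 2 := by
  classical
  unfold gcnt
  by_cases h5 : y5 = 0
  · by_cases h4 : y4 = 0
    · have h3 : y3 ≠ 0 := fun h3 => h ⟨h3, h4, h5⟩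
      simp [h4, h5, h3, sq]
    · have : ∀ a3 a4 : F, a3 * y3 + a4 * y4 = 0 ↔ a4 = -(a3 * y3) / y4 := by
        intro a b
        rw [eq_div_iff h4]
        constructor <;> intro h <;> linear_combination h
      simp [h5, this, sq]
  · have : ∀ a3 a4 a5 : F, a3 * y3 + a4 * y4 + a5 * y5 = 0 ↔
        a5 = -(a3 * y3 + a4 * y4) / y5 := by
      intro a b c
      rw [eq_div_iff h5]
      constructor <;> intro h <;> linear_combination h
    simp [this, sq]

open Classical in
theorem cnt_case1 (y1 y3 y4 y5 : F) (h1 : y1 ≠ 0) :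
    cnt ![0, y1, 0, y3, y4, y5] + (if y5 = 0 then Fintype.card F ^ 2 else 0)
      = Fintype.card F ^ 4 + (if y5 = 0 then Fintype.card F ^ 3 else 0) := by
  classical
  set q := Fintype.card F with hq
  have key : ∀ a3 a4 a5 : F,
      (∑ a2 : F, ∑ a1 : F, ∑ a0 : F,
        if disc ![a0, a1, a2, a3, a4, a5] = 0 ∧
          Bform ![a0, a1, a2, a3, a4, a5] ![0, y1, 0, y3, y4, y5] = 0 then 1 else 0)
        + (if a3 = 0 then if a4 = 0 then q else 0 else 0)
      = q + (if a3 = 0 then if a4 = 0 then (if a5 * y5 = 0 then q ^ 2 else 0) else 0 else 0) := by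
    intro a3 a4 a5
    set lam : F := -(a3 * y3 + a4 * y4 + a5 * y5) / y1 with hlam
    have hB : ∀ a0 a1 a2 : F, Bform ![a0, a1, a2, a3, a4, a5] ![0, y1, 0, y3, y4, y5] = 0
        ↔ a1 = lam := by
      intro a0 a1 a2
      simp only [Bform, Matrix.cons_val]
      rw [hlam, eq_div_iff h1]
      constructor <;> intro h <;> linear_combination h
    have step : ∀ a2 a1 : F, (∑ a0 : F,
        if disc ![a0, a1, a2, a3, a4, a5] = 0 ∧ a1 = lam then 1 else 0) =
        if a1 = lam then (∑ a0 : F,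
        if disc ![a0, lam, a2, a3, a4, a5] = 0 then 1 else 0) else 0 := by
      intro a2 a1
      split_ifs with h
      · simp [h]
      · simp [h]
    simp only [hB]
    simp only [step, Finset.sum_ite_eq', Finset.mem_univ, if_true]
    simp only [disc_vec]
    by_cases hD : 4 * a3 * a5 - a4 ^ 2 = 0
    · simp only [hD, mul_zero]
      by_cases h3 : a3 = 0
      · have h4 : a4 = 0 := by
          have : a4 ^ 2 = 0 := by rw [h3] at hD; linear_combination -hD
          exact pow_eq_zero_iff (two_ne_zero) |>.1 this
        have h5 : (0 = a5 * lam ^ 2) ↔ a5 * y5 = 0 := by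
          rw [hlam, h3, h4, eq_comm]
          simp [h1]
        simp only [h3, h4, zero_mul, sub_zero, zero_add, h5, if_true]
        split_ifs
        · simp [← hq]; ring
        · simp
      · obtain ⟨β, hβ⟩ := beta_iff h3 (sub_eq_zero.1 hD)
        have : ∀ a2 : F, (0 = a3 * a2 ^ 2 - a4 * lam * a2 + a5 * lam ^ 2) ↔ a2 = β * lam :=
          fun a2 => by rw [eq_comm, hβ]
        simp only [this, h3, if_false]
        rw [Finset.sum_comm]
        simp [hq]
    · simp only [sum_a0 hD]
      have : ¬ (a3 = 0 ∧ a4 = 0) := by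
        rintro ⟨rfl, rfl⟩
        exact hD (by ring)
      by_cases h3 : a3 = 0
      · have h4 : a4 ≠ 0 := fun h4 => this ⟨h3, h4⟩
        simp [h3, h4, hq]
      · simp [h3, hq]
  unfold cnt
  rw [sum6]
  have := Finset.sum_congr (rfl : (Finset.univ : Finset F) = Finset.univ) fun a3 _ =>
    Finset.sum_congr (rfl : (Finset.univ : Finset F) = Finset.univ) fun a4 _ =>
    Finset.sum_congr (rfl : (Finset.univ : Finset F) = Finset.univ) fun a5 _ => key a3 a4 a5
  simp only [Finset.sum_add_distrib, Finset.sum_const, Finset.card_univ, ← hq, smul_eq_mul] at this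
  have e1 : (∑ x : F, ∑ x_1 : F, q * if x = 0 then if x_1 = 0 then q else 0 else 0) = q ^ 2 := by
    simp [sq]
  have e2 : (∑ x : F, ∑ x_1 : F, ∑ x_2 : F,
      if x = 0 then if x_1 = 0 then if x_2 * y5 = 0 then q ^ 2 else 0 else 0 else 0)
      = if y5 = 0 then q ^ 3 else q ^ 2 := by
    split_ifs with h
    · simp [h, ← hq]; ring
    · simp [h]
  rw [e1, e2] at this
  split_ifs at this ⊢
  · linarith
  · linarith

end Counting

section Normalization

set_option linter.unusedSectionVars false

variable {F : Type} [Field F] [Fintype F]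

/-- determinant of `M y` -/
def dm (y : Fin 6 → F) : F :=
  y 0 * y 3 * y 5 + 2 * y 1 * y 2 * y 4 - y 0 * y 4 ^ 2 - y 3 * y 2 ^ 2 - y 5 * y 1 ^ 2

theorem det_M (y : Fin 6 → F) : (M y).det = dm y := by
  simp [M, dm, Matrix.det_fin_three]
  ring

def Good (y : Fin 6 → F) : Prop :=
  (dm y = 0 → cnt y + Fintype.card F ^ 2 = Fintype.card F ^ 4 + Fintype.card F ^ 3) ∧
  (dm y ≠ 0 → cnt y = Fintype.card F ^ 4)

theorem good_transfer (f g : (Fin 6 → F) → (Fin 6 → F)) (hfg : ∀ a, f (g a) = a)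
    (hgf : ∀ a, g (f a) = a) (y y' : Fin 6 → F) (hdisc : ∀ a, disc (f a) = disc a)
    (hB : ∀ a, Bform (f a) y' = Bform a y) (hdm : dm y' = dm y) (h : Good y') : Good y := by
  have : cnt y = cnt y' := by
    classical
    symm
    unfold cnt
    rw [← Equiv.sum_comp (⟨f, g, hgf, hfg⟩ : (Fin 6 → F) ≃ (Fin 6 → F))]
    refine Finset.sum_congr rfl fun a _ => ?_
    exact if_congr (by simp only [Equiv.coe_fn_mk, hdisc, hB]) rfl rfl
  unfold Good at *
  rw [this, ← hdm]
  exact h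

theorem good_swap01 (y : Fin 6 → F) (h : Good ![y 3, y 1, y 4, y 0, y 2, y 5]) : Good y := by
  refine good_transfer (fun a => ![a 3, a 1, a 4, a 0, a 2, a 5])
    (fun a => ![a 3, a 1, a 4, a 0, a 2, a 5]) ?_ ?_ y _ ?_ ?_ ?_ h
  · intro a; ext i; fin_cases i <;> rfl
  · intro a; ext i; fin_cases i <;> rfl
  · intro a; simp only [disc, Matrix.cons_val]; ring
  · intro a; simp only [Bform, Matrix.cons_val]; ring
  · simp only [dm, Matrix.cons_val]; ring

theorem good_swap02 (y : Fin 6 → F) (h : Good ![y 5, y 4, y 2, y 3, y 1, y 0]) : Good y := by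
  refine good_transfer (fun a => ![a 5, a 4, a 2, a 3, a 1, a 0])
    (fun a => ![a 5, a 4, a 2, a 3, a 1, a 0]) ?_ ?_ y _ ?_ ?_ ?_ h
  · intro a; ext i; fin_cases i <;> rfl
  · intro a; ext i; fin_cases i <;> rfl
  · intro a; simp only [disc, Matrix.cons_val]; ring
  · intro a; simp only [Bform, Matrix.cons_val]; ring
  · simp only [dm, Matrix.cons_val]; ring

theorem good_swap12 (y : Fin 6 → F) (h : Good ![y 0, y 2, y 1, y 5, y 4, y 3]) : Good y := by
  refine good_transfer (fun a => ![a 0, a 2, a 1, a 5, a 4, a 3])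
    (fun a => ![a 0, a 2, a 1, a 5, a 4, a 3]) ?_ ?_ y _ ?_ ?_ ?_ h
  · intro a; ext i; fin_cases i <;> rfl
  · intro a; ext i; fin_cases i <;> rfl
  · intro a; simp only [disc, Matrix.cons_val]; ring
  · intro a; simp only [Bform, Matrix.cons_val]; ring
  · simp only [dm, Matrix.cons_val]; ring

def tr0 (p s : F) (a : Fin 6 → F) : Fin 6 → F :=
  ![a 0, 2 * p * a 0 + a 1, 2 * s * a 0 + a 2, p ^ 2 * a 0 + p * a 1 + a 3,
    2 * p * s * a 0 + s * a 1 + p * a 2 + a 4, s ^ 2 * a 0 + s * a 2 + a 5]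

theorem tr0_inv (p s : F) (a : Fin 6 → F) : tr0 p s (tr0 (-p) (-s) a) = a := by
  ext i
  fin_cases i <;> simp [tr0] <;> ring

theorem good_tr0 (p s : F) (y : Fin 6 → F)
    (h : Good ![y 0 + 2 * p * y 1 + 2 * s * y 2 + p ^ 2 * y 3 + 2 * p * s * y 4 + s ^ 2 * y 5,
      y 1 + p * y 3 + s * y 4, y 2 + p * y 4 + s * y 5, y 3, y 4, y 5]) : Good y := by
  refine good_transfer (tr0 (-p) (-s)) (tr0 p s) ?_ ?_ y _ ?_ ?_ ?_ h
  · intro a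
    simpa using tr0_inv (-p) (-s) a
  · intro a; exact tr0_inv p s a
  · intro a; simp only [disc, tr0, Matrix.cons_val]; ring
  · intro a; simp only [Bform, tr0, Matrix.cons_val]; ring
  · simp only [dm, Matrix.cons_val]; ring

def tr1 (t : F) (a : Fin 6 → F) : Fin 6 → F :=
  ![a 0, a 1 + t * a 2, a 2, a 3 + t * a 4 + t ^ 2 * a 5, a 4 + 2 * t * a 5, a 5]

theorem tr1_inv (t : F) (a : Fin 6 → F) : tr1 t (tr1 (-t) a) = a := by
  ext i
  fin_cases i <;> simp [tr1] <;> ring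

theorem good_tr1 (t : F) (y : Fin 6 → F)
    (h : Good ![y 0, y 1, y 2 + t * y 1, y 3, y 4 + t * y 3, y 5 + 2 * t * y 4 + t ^ 2 * y 3]) :
    Good y := by
  refine good_transfer (tr1 (-t)) (tr1 t) ?_ ?_ y _ ?_ ?_ ?_ h
  · intro a
    simpa using tr1_inv (-t) a
  · intro a; exact tr1_inv t a
  · intro a; simp only [disc, tr1, Matrix.cons_val]; ring
  · intro a; simp only [Bform, tr1, Matrix.cons_val]; ring
  · simp only [dm, Matrix.cons_val]; ring

theorem good_y02 (y1 y3 y4 y5 : F) (h1 : y1 ≠ 0) : Good ![0, y1, 0, y3, y4, y5] := by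
  have h := cnt_case1 y1 y3 y4 y5 h1
  have hd : dm ![0, y1, 0, y3, y4, y5] = 0 ↔ y5 = 0 := by
    simp [dm, h1]
  refine ⟨fun h0 => ?_, fun h0 => ?_⟩
  · simpa [hd.1 h0] using h
  · have : y5 ≠ 0 := fun h5 => h0 (hd.2 h5)
    simpa [this] using h

theorem good_y0a (y1 y2 y3 y4 y5 : F) (h1 : y1 ≠ 0) : Good ![0, y1, y2, y3, y4, y5] := by
  apply good_tr1 (-(y2 / y1))
  simp only [Matrix.cons_val]
  have : y2 + -(y2 / y1) * y1 = 0 := by field_simp; ring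
  rw [this]
  exact good_y02 _ _ _ _ h1

theorem good_y0 (y : Fin 6 → F) (hy : y ≠ 0) (h0 : y 0 = 0) : Good y := by
  have he : y = ![0, y 1, y 2, y 3, y 4, y 5] := by
    ext i; fin_cases i <;> simp [h0]
  by_cases h1 : y 1 = 0
  · by_cases h2 : y 2 = 0
    · rw [h1, h2] at he
      have hne : ¬ (y 3 = 0 ∧ y 4 = 0 ∧ y 5 = 0) := by
        rintro ⟨h3, h4, h5⟩
        apply hy
        ext i; fin_cases i <;> simp [h0, h1, h2, h3, h4, h5]
      have := cnt_case0 (y 3) (y 4) (y 5)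
      rw [gcnt_ne _ _ _ hne, ← he] at this
      refine ⟨fun _ => by rw [this]; ring, fun h => absurd ?_ h⟩
      simp [dm, h0, h1, h2]
    · apply good_swap12
      rw [h0]
      exact good_y0a _ _ _ _ _ h2
  · rw [he]
    exact good_y0a _ _ _ _ _ h1

theorem exists_isotropic (y : Fin 6 → F) : ∃ p : Fin 3 → F, p ≠ 0 ∧
    y 0 * p 0 ^ 2 + 2 * y 1 * p 0 * p 1 + 2 * y 2 * p 0 * p 2 + y 3 * p 1 ^ 2
      + 2 * y 4 * p 1 * p 2 + y 5 * p 2 ^ 2 = 0 := by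
  classical
  let f : MvPolynomial (Fin 3) F :=
    MvPolynomial.C (y 0) * (MvPolynomial.X 0 * MvPolynomial.X 0)
    + MvPolynomial.C (2 * y 1) * (MvPolynomial.X 0 * MvPolynomial.X 1)
    + MvPolynomial.C (2 * y 2) * (MvPolynomial.X 0 * MvPolynomial.X 2)
    + MvPolynomial.C (y 3) * (MvPolynomial.X 1 * MvPolynomial.X 1)
    + MvPolynomial.C (2 * y 4) * (MvPolynomial.X 1 * MvPolynomial.X 2)
    + MvPolynomial.C (y 5) * (MvPolynomial.X 2 * MvPolynomial.X 2)
  have ht : ∀ (c : F) (i j : Fin 3), (MvPolynomial.C c *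
      (MvPolynomial.X i * MvPolynomial.X j) : MvPolynomial (Fin 3) F).totalDegree ≤ 2 := by
    intro c i j
    refine (MvPolynomial.totalDegree_mul _ _).trans ?_
    rw [MvPolynomial.totalDegree_C, zero_add]
    refine (MvPolynomial.totalDegree_mul _ _).trans ?_
    simp
  have hadd : ∀ g h : MvPolynomial (Fin 3) F, g.totalDegree ≤ 2 → h.totalDegree ≤ 2 →
      (g + h).totalDegree ≤ 2 := fun g h hg hh =>
    (MvPolynomial.totalDegree_add _ _).trans (max_le hg hh)
  have hf : f.totalDegree < Fintype.card (Fin 3) := by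
    have : f.totalDegree ≤ 2 :=
      hadd _ _ (hadd _ _ (hadd _ _ (hadd _ _ (hadd _ _ (ht _ _ _) (ht _ _ _)) (ht _ _ _))
        (ht _ _ _)) (ht _ _ _)) (ht _ _ _)
    simp; omega
  obtain ⟨p, hp⟩ := CharP.exists F
  have hdvd := char_dvd_card_solutions p hf
  have hprime : p.Prime := by
    rcases CharP.char_is_prime_or_zero F p with h | h
    · exact h
    · subst h
      exact absurd rfl (CharP.char_ne_zero_of_finite F 0)
  let z : { x : Fin 3 → F // MvPolynomial.eval x f = 0 } := ⟨0, by simp [f]⟩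
  have hpos : 0 < Fintype.card { x : Fin 3 → F // MvPolynomial.eval x f = 0 } :=
    Fintype.card_pos_iff.2 ⟨z⟩
  have h1 : 1 < Fintype.card { x : Fin 3 → F // MvPolynomial.eval x f = 0 } :=
    lt_of_lt_of_le hprime.one_lt (Nat.le_of_dvd hpos hdvd)
  obtain ⟨⟨x, hx⟩, hne⟩ := Fintype.exists_ne_of_one_lt_card h1 z
  refine ⟨x, fun h => hne (Subtype.ext h), ?_⟩
  simp [f] at hx
  linear_combination hx

theorem good_p0 (y : Fin 6 → F) (hy : y ≠ 0) (p : Fin 3 → F) (h0 : p 0 ≠ 0)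
    (hp : y 0 * p 0 ^ 2 + 2 * y 1 * p 0 * p 1 + 2 * y 2 * p 0 * p 2 + y 3 * p 1 ^ 2
      + 2 * y 4 * p 1 * p 2 + y 5 * p 2 ^ 2 = 0) : Good y := by
  apply good_tr0 (p 1 / p 0) (p 2 / p 0)
  have e : y 0 + 2 * (p 1 / p 0) * y 1 + 2 * (p 2 / p 0) * y 2 + (p 1 / p 0) ^ 2 * y 3
      + 2 * (p 1 / p 0) * (p 2 / p 0) * y 4 + (p 2 / p 0) ^ 2 * y 5 = 0 := by
    field_simp
    linear_combination hp
  apply good_y0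
  · intro h
    apply hy
    have h0 := congrFun h 0
    have h1 := congrFun h 1
    have h2 := congrFun h 2
    have h3 := congrFun h 3
    have h4 := congrFun h 4
    have h5 := congrFun h 5
    simp only [Matrix.cons_val, Pi.zero_apply] at h0 h1 h2 h3 h4 h5
    simp only [h3, h4, h5, mul_zero, add_zero] at h1 h2
    simp only [h1, h2, h3, h4, h5, mul_zero, add_zero] at h0
    ext i; fin_cases i <;> simp [h0, h1, h2, h3, h4, h5]
  · simpa using e

theorem good_all (y : Fin 6 → F) (hy : y ≠ 0) : Good y := by
  obtain ⟨p, hp, h⟩ := exists_isotropic y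
  by_cases h0 : p 0 = 0
  · by_cases h1 : p 1 = 0
    · have h2 : p 2 ≠ 0 := by
        intro h2
        apply hp
        ext i; fin_cases i <;> simp [h0, h1, h2]
      apply good_swap02
      refine good_p0 _ ?_ ![p 2, p 1, p 0] h2 ?_
      · intro h
        apply hy
        ext i; fin_cases i
        exacts [congrFun h 5, congrFun h 4, congrFun h 2, congrFun h 3, congrFun h 1, congrFun h 0]
      · simp only [Matrix.cons_val]; linear_combination h
    · apply good_swap01
      refine good_p0 _ ?_ ![p 1, p 0, p 2] h1 ?_
      · intro h
        apply hy
        ext i; fin_cases i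
        exacts [congrFun h 3, congrFun h 1, congrFun h 4, congrFun h 0, congrFun h 2, congrFun h 5]
      · simp only [Matrix.cons_val]; linear_combination h
  · exact good_p0 y hy p h0 h

theorem cnt_zero : cnt (0 : Fin 6 → F) + Fintype.card F ^ 2
    = Fintype.card F ^ 5 + Fintype.card F ^ 3 := by
  have := cnt_case0 (0 : F) 0 0
  rw [gcnt_zero] at this
  have e : (![0, 0, 0, 0, 0, 0] : Fin 6 → F) = 0 := by
    ext i; fin_cases i <;> rfl
  rw [e] at this
  rw [this]; ring

theorem rank_le_two_iff (y : Fin 6 → F) : (M y).rank ≤ 2 ↔ dm y = 0 := by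
  rw [← det_M]
  constructor
  · intro h
    by_contra hd
    have := Matrix.rank_of_isUnit (M y) ((Matrix.isUnit_iff_isUnit_det _).2 (Ne.isUnit hd))
    simp at this
    omega
  · intro h
    obtain ⟨v, hv, hv0⟩ := Matrix.exists_mulVec_eq_zero_iff.2 h
    by_contra hr
    have hk := LinearMap.finrank_range_add_finrank_ker (M y).mulVecLin
    have hpos : 0 < Module.finrank F (LinearMap.ker (M y).mulVecLin) := by
      rw [Module.finrank_pos_iff_exists_ne_zero]
      exact ⟨⟨v, by simpa using hv0⟩, fun h => hv (congrArg Subtype.val h)⟩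
    unfold Matrix.rank at hr
    simp at hk
    omega

end Normalization

section Averaging

set_option linter.unusedSectionVars false

variable {F : Type} [Field F] [Fintype F]

open Classical in
theorem proj_count (T : (Fin 6 → F) → Prop) [DecidablePred T]
    (hT : ∀ (c : F) (a : Fin 6 → F), c ≠ 0 → T a → T (c • a)) :
    Finset.card {a : Fin 6 → F | a ≠ 0 ∧ T a} =
    Set.ncard {P : Submodule F (Fin 6 → F) | ∃ a : Fin 6 → F, a ≠ 0 ∧ T a ∧
      P = Submodule.span F {a}} * (Fintype.card F - 1) := by
  set S : Finset (Fin 6 → F) := {a : Fin 6 → F | a ≠ 0 ∧ T a} with hS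
  have hset : {P : Submodule F (Fin 6 → F) | ∃ a : Fin 6 → F, a ≠ 0 ∧ T a ∧
      P = Submodule.span F {a}} = ↑(S.image fun a => Submodule.span F {a}) := by
    ext P
    simp only [Set.mem_ofPred_eq, Finset.coe_image, Set.mem_image, hS, Finset.mem_coe,
      Finset.mem_filter, Finset.mem_univ, true_and]
    constructor
    · rintro ⟨a, h1, h2, rfl⟩
      exact ⟨a, ⟨h1, h2⟩, rfl⟩
    · rintro ⟨a, ⟨h1, h2⟩, rfl⟩
      exact ⟨a, h1, h2, rfl⟩
  rw [hset, Set.ncard_coe_finset, Finset.card_eq_sum_card_image (fun a => Submodule.span F {a}) S]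
  apply Finset.sum_const_nat
  intro P hP
  obtain ⟨a, ha, rfl⟩ := Finset.mem_image.1 hP
  simp only [hS, Finset.mem_filter, Finset.mem_univ, true_and] at ha
  have : S.filter (fun b => Submodule.span F {b} = Submodule.span F {a})
      = (Finset.univ : Finset Fˣ).image (fun u => u • a) := by
    ext b
    simp only [hS, Finset.mem_filter, Finset.mem_univ, true_and, Finset.mem_image]
    constructor
    · rintro ⟨_, h⟩
      exact Submodule.span_singleton_eq_span_singleton.1 h.symm
    · rintro ⟨u, rfl⟩
      refine ⟨⟨?_, ?_⟩, (Submodule.span_singleton_eq_span_singleton.2 ⟨u, rfl⟩).symm⟩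
      · rw [Units.smul_def]
        exact smul_ne_zero u.ne_zero ha.1
      · rw [Units.smul_def]
        exact hT _ _ u.ne_zero ha.2
  rw [this, Finset.card_image_of_injective, Finset.card_univ, Fintype.card_units]
  intro u v huv
  simp only [Units.smul_def] at huv
  exact Units.ext (smul_left_injective F ha.1 huv)

open Classical in
theorem card_hyper {V : Type} [AddCommGroup V] [Module F V] [Fintype V] (φ : V →ₗ[F] F)
    (h : φ ≠ 0) : Finset.card {v : V | φ v = 0} * Fintype.card F = Fintype.card V := by
  have h1 : Finset.card {v : V | φ v = 0} = Fintype.card (LinearMap.ker φ) := by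
    rw [Fintype.card_subtype]
    simp
  have : Module.Finite F V := Module.Finite.of_finite
  have hr := LinearMap.finrank_range_add_finrank_ker φ
  rw [LinearMap.range_eq_top.2 (LinearMap.surjective h), finrank_top, Module.finrank_self] at hr
  rw [h1, Module.card_eq_pow_finrank (K := F) (V := LinearMap.ker φ),
    Module.card_eq_pow_finrank (K := F) (V := V), ← hr]
  ring

/-- `Bform` as a functional in the second argument. -/
def Bright (a : Fin 6 → F) : (Fin 6 → F) →ₗ[F] F where
  toFun y := Bform a y
  map_add' x y := by simp only [Bform, Pi.add_apply]; ring
  map_smul' c x := by simp only [Bform, Pi.smul_apply, smul_eq_mul, RingHom.id_apply]; ring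

theorem Bform_comm (a y : Fin 6 → F) : Bform a y = Bform y a := by
  simp only [Bform]; ring

theorem Bright_ne (y : Fin 6 → F) (hy : y ≠ 0) : Bright y ≠ 0 := by
  intro h
  apply hy
  ext i
  have := LinearMap.congr_fun h (Pi.single i 1)
  fin_cases i <;> simpa [Bright, Bform, Pi.single_apply] using this

open Classical in
theorem avg (L : Submodule F (Fin 6 → F)) (hL : Module.finrank F L = 2)
    (T : (Fin 6 → F) → Prop) :
    (∑ y : L, Finset.card {a : Fin 6 → F | T a ∧ Bform a y = 0})
      + Fintype.card F * Finset.card {a : Fin 6 → F | T a ∧ a ∈ perp L}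
    = Fintype.card F * Finset.card {a : Fin 6 → F | T a}
      + Fintype.card F ^ 2 * Finset.card {a : Fin 6 → F | T a ∧ a ∈ perp L} := by
  set q := Fintype.card F with hq
  have hLc : Fintype.card L = q ^ 2 := by
    rw [Module.card_eq_pow_finrank (K := F) (V := L), hL]
  have hq0 : 0 < q := Fintype.card_pos
  have key : ∀ a : Fin 6 → F, (∑ y : L, if T a ∧ Bform a y = 0 then 1 else 0)
      + q * (if T a ∧ a ∈ perp L then 1 else 0)
      = q * (if T a then 1 else 0) + q ^ 2 * (if T a ∧ a ∈ perp L then 1 else 0) := by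
    intro a
    by_cases hT : T a
    · by_cases hp : a ∈ perp L
      · have : ∀ y : L, Bform a y = 0 := fun y => hp y y.2
        simp [hT, hp, this, hLc]
        ring
      · simp only [hT, hp, true_and, if_true, if_false, mul_zero, add_zero, mul_one]
        have hne : (Bright a).comp L.subtype ≠ 0 := by
          intro h
          apply hp
          intro y hy
          exact LinearMap.congr_fun h ⟨y, hy⟩
        have := card_hyper _ hne
        rw [hLc, sq] at this
        have := Nat.eq_of_mul_eq_mul_right hq0 this
        rw [← Finset.card_filter]
        exact this
    · simp [hT]
  have := Finset.sum_congr (rfl : (Finset.univ : Finset (Fin 6 → F)) = Finset.univ)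
    fun a _ => key a
  simp only [Finset.sum_add_distrib, ← Finset.mul_sum] at this
  rw [Finset.sum_comm] at this
  simpa only [Finset.card_filter] using this

open Classical in
theorem card_perp (L : Submodule F (Fin 6 → F)) (hL : Module.finrank F L = 2) :
    Finset.card {a : Fin 6 → F | a ∈ perp L} = Fintype.card F ^ 4 := by
  have h := avg L hL (fun _ => True)
  simp only [true_and] at h
  set q := Fintype.card F with hq
  have hLc : Fintype.card L = q ^ 2 := by
    rw [Module.card_eq_pow_finrank (K := F) (V := L), hL]
  have hq1 : 1 < q := Fintype.one_lt_card
  have h6 : Fintype.card (Fin 6 → F) = q ^ 6 := by simp [hq]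
  have hy : ∀ y : L, (Finset.card {a : Fin 6 → F | Bform a y = 0} : ℤ)
      = q ^ 5 + if y = 0 then (q : ℤ) ^ 6 - q ^ 5 else 0 := by
    intro y
    by_cases h0 : y = 0
    · subst h0
      simp [Bform, hq]
    · have hne : (y : Fin 6 → F) ≠ 0 := fun h => h0 (Subtype.ext h)
      have := card_hyper _ (Bright_ne _ hne)
      rw [h6] at this
      have h5 : Finset.card {v : Fin 6 → F | Bright (y : Fin 6 → F) v = 0} = q ^ 5 := by
        apply Nat.eq_of_mul_eq_mul_right (by omega : 0 < q)
        rw [this]; ring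
      have e : Finset.card {a : Fin 6 → F | Bform a y = 0} = q ^ 5 := by
        rw [← h5]
        congr 1
        ext a
        simp only [Finset.mem_filter, Finset.mem_univ, true_and, Bform_comm a]
        rfl
      simp [h0, e]
  have hz := congrArg (Nat.cast : ℕ → ℤ) h
  push_cast at hz
  simp only [hy, Finset.sum_add_distrib] at hz
  simp [hLc, ← hq] at hz
  have hq0 : (q : ℤ) ^ 2 - q ≠ 0 := by
    have : (1 : ℤ) < q := by exact_mod_cast hq1
    nlinarith
  have : ((Finset.card {a : Fin 6 → F | a ∈ perp L} : ℕ) : ℤ) = q ^ 4 := by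
    apply mul_left_cancel₀ hq0
    linear_combination -hz
  exact_mod_cast this

theorem dm_smul (c : F) (y : Fin 6 → F) : dm (c • y) = c ^ 3 * dm y := by
  simp only [dm, Pi.smul_apply, smul_eq_mul]; ring

theorem disc_smul (c : F) (y : Fin 6 → F) : disc (c • y) = c ^ 3 * disc y := by
  simp only [disc, Pi.smul_apply, smul_eq_mul]; ring

open Classical in
theorem card_with_zero (T : (Fin 6 → F) → Prop) [DecidablePred T] (h0 : T 0) :
    Finset.card {a : Fin 6 → F | T a} = Finset.card {a : Fin 6 → F | a ≠ 0 ∧ T a} + 1 := by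
  rw [← Finset.card_insert_of_notMem (a := (0 : Fin 6 → F)) (by simp)]
  congr 1
  ext a
  by_cases h : a = 0
  · simp [h, h0]
  · simp [h]

open Classical in
theorem card_sing (L : Submodule F (Fin 6 → F)) (hL : Module.finrank F L = 2) (r : ℕ)
    (hr : Finset.card {y : Fin 6 → F | y ∈ L ∧ dm y = 0} = r * (Fintype.card F - 1) + 1) :
    (Finset.card {a : Fin 6 → F | disc a = 0 ∧ a ∈ perp L} : ℤ)
      = (Fintype.card F : ℤ) ^ 3 - (Fintype.card F : ℤ) ^ 2 + Fintype.card F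
        + r * Fintype.card F * ((Fintype.card F : ℤ) - 1) := by
  have h := avg L hL (fun a => disc a = 0)
  set q := Fintype.card F with hq
  have hLc : Fintype.card L = q ^ 2 := by
    rw [Module.card_eq_pow_finrank (K := F) (V := L), hL]
  have hq1 : 1 < q := Fintype.one_lt_card
  have hcnt : ∀ y : Fin 6 → F, Finset.card {a : Fin 6 → F | disc a = 0 ∧ Bform a y = 0} = cnt y := by
    intro y
    rw [cnt, Finset.card_filter]
  have hy : ∀ y : L, (cnt (y : Fin 6 → F) : ℤ) = q ^ 4
      + (if dm (y : Fin 6 → F) = 0 then (q : ℤ) ^ 3 - q ^ 2 else 0)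
      + (if y = 0 then (q : ℤ) ^ 5 - q ^ 4 else 0) := by
    intro y
    by_cases h0 : y = 0
    · subst h0
      have hz := congrArg (Nat.cast : ℕ → ℤ) (cnt_zero (F := F))
      push_cast at hz
      simp only [← hq] at hz
      simp [dm]
      linear_combination hz
    · have hne : (y : Fin 6 → F) ≠ 0 := fun h => h0 (Subtype.ext h)
      have hg := good_all _ hne
      by_cases hd : dm (y : Fin 6 → F) = 0
      · have hz := congrArg (Nat.cast : ℕ → ℤ) (hg.1 hd)
        push_cast at hz
        simp only [← hq] at hz
        simp [h0, hd]
        linear_combination hz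
      · have hz := congrArg (Nat.cast : ℕ → ℤ) (hg.2 hd)
        push_cast at hz
        simp only [← hq] at hz
        simp [h0, hd]
        linear_combination hz
  have hS : Finset.card {a : Fin 6 → F | disc a = 0} = cnt (0 : Fin 6 → F) := by
    rw [← hcnt]
    congr 1
    ext a
    simp [Bform]
  have hr' : Finset.card {y : L | dm (y : Fin 6 → F) = 0} = r * (q - 1) + 1 := by
    rw [← hr]
    apply Finset.card_bij (fun (y : L) _ => (y : Fin 6 → F))
    · intro y hy
      simpa using hy
    · intro x _ y _ h
      exact Subtype.ext h
    · intro y hy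
      simp at hy
      exact ⟨⟨y, hy.1⟩, by simpa using hy.2, rfl⟩
  have hz := congrArg (Nat.cast : ℕ → ℤ) h
  push_cast at hz
  simp only [hcnt, hS, hy, Finset.sum_add_distrib] at hz
  have c0 := congrArg (Nat.cast : ℕ → ℤ) (cnt_zero (F := F))
  push_cast at c0
  have e1 : (∑ y : L, if dm (y : Fin 6 → F) = 0 then (q : ℤ) ^ 3 - q ^ 2 else 0)
      = (r * ((q : ℤ) - 1) + 1) * (q ^ 3 - q ^ 2) := by
    rw [← Finset.sum_filter, Finset.sum_const, hr', nsmul_eq_mul]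
    push_cast [Nat.cast_sub hq1.le]
    ring
  rw [e1] at hz
  simp only [Finset.sum_const, Finset.card_univ, hLc, Finset.sum_ite_eq', Finset.mem_univ,
    if_true, nsmul_eq_mul, ← hq] at hz c0
  push_cast at hz
  have hq0 : (q : ℤ) ^ 2 - q ≠ 0 := by
    have : (1 : ℤ) < q := by exact_mod_cast hq1
    nlinarith
  apply mul_left_cancel₀ hq0
  linear_combination -hz - q * c0

theorem r_le_three (L : Submodule F (Fin 6 → F)) (hL : Module.finrank F L = 2)
    (u : Fin 6 → F) (hu : u ∈ L) (hd : dm u ≠ 0) :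
    Set.ncard {P : Submodule F (Fin 6 → F) |
      ∃ y : Fin 6 → F, y ≠ 0 ∧ (y ∈ L ∧ dm y = 0) ∧ P = Submodule.span F {y}} ≤ 3 := by
  classical
  have hu0 : u ≠ 0 := by
    rintro rfl
    exact hd (by simp [dm])
  -- a complement
  have hlt : Submodule.span F {u} < L := by
    refine lt_of_le_of_ne (by simpa using hu) ?_
    intro h
    have := finrank_span_singleton (K := F) hu0
    rw [h, hL] at this
    omega
  obtain ⟨w, hw, hwu⟩ := SetLike.exists_of_lt hlt
  have hLe : Submodule.span F {u, w} = L := by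
    apply Submodule.eq_of_le_of_finrank_le
    · rw [Submodule.span_le]
      rintro x (rfl | rfl)
      · exact hu
      · exact hw
    · rw [hL]
      have : LinearIndependent F ![u, w] := by
        rw [LinearIndependent.pair_iff' hu0]
        intro a ha
        exact hwu (Submodule.mem_span_singleton.2 ⟨a, ha⟩)
      have := finrank_span_eq_card this
      rw [Matrix.range_cons_cons_empty] at this
      simp [this]
  -- the cubic
  let c0 : F := dm w
  let c1 : F := w 0 * w 3 * u 5 + w 0 * u 3 * w 5 + u 0 * w 3 * w 5
    + 2 * (w 1 * w 2 * u 4 + w 1 * u 2 * w 4 + u 1 * w 2 * w 4)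
    - (u 0 * w 4 ^ 2 + 2 * w 0 * w 4 * u 4) - (u 3 * w 2 ^ 2 + 2 * w 3 * w 2 * u 2)
    - (u 5 * w 1 ^ 2 + 2 * w 5 * w 1 * u 1)
  let c2 : F := u 0 * u 3 * w 5 + u 0 * w 3 * u 5 + w 0 * u 3 * u 5
    + 2 * (u 1 * u 2 * w 4 + u 1 * w 2 * u 4 + w 1 * u 2 * u 4)
    - (w 0 * u 4 ^ 2 + 2 * u 0 * u 4 * w 4) - (w 3 * u 2 ^ 2 + 2 * u 3 * u 2 * w 2)
    - (w 5 * u 1 ^ 2 + 2 * u 5 * u 1 * w 1)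
  let f : Polynomial F := Polynomial.C (dm u) * Polynomial.X ^ 3 + Polynomial.C c2 * Polynomial.X ^ 2
    + Polynomial.C c1 * Polynomial.X + Polynomial.C c0
  have hdeg : f.natDegree = 3 := Polynomial.natDegree_cubic hd
  have hf0 : f ≠ 0 := by
    intro h
    rw [h] at hdeg
    simp at hdeg
  have heval : ∀ t : F, f.eval t = dm (w + t • u) := by
    intro t
    simp [f, c0, c1, c2, dm]
    ring
  have hsub : {P : Submodule F (Fin 6 → F) |
      ∃ y : Fin 6 → F, y ≠ 0 ∧ (y ∈ L ∧ dm y = 0) ∧ P = Submodule.span F {y}} ⊆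
      ↑(f.roots.toFinset.image fun t => Submodule.span F {w + t • u}) := by
    rintro P ⟨y, hy0, ⟨hyL, hyd⟩, rfl⟩
    rw [← hLe, Submodule.mem_span_pair] at hyL
    obtain ⟨s, t, rfl⟩ := hyL
    have ht : t ≠ 0 := by
      rintro rfl
      simp only [zero_smul, add_zero] at hy0 hyd
      rw [dm_smul] at hyd
      have hs : s ≠ 0 := by
        rintro rfl
        simp at hy0
      exact (mul_ne_zero (pow_ne_zero 3 hs) hd) hyd
    have he : s • u + t • w = t • (w + (s / t) • u) := by
      rw [smul_add, smul_smul, mul_div_cancel₀ _ ht, add_comm]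
    rw [Finset.coe_image, Set.mem_image]
    refine ⟨s / t, ?_, ?_⟩
    · rw [Finset.mem_coe, Multiset.mem_toFinset, Polynomial.mem_roots hf0, Polynomial.IsRoot.def, heval]
      rw [he, dm_smul] at hyd
      exact (mul_eq_zero.1 hyd).resolve_left (pow_ne_zero 3 ht)
    · simp only [he]
      rw [Submodule.span_singleton_eq_span_singleton]
      exact ⟨Units.mk0 t ht, rfl⟩
  refine (Set.ncard_le_ncard hsub (Finset.finite_toSet _)).trans ?_
  rw [Set.ncard_coe_finset]
  calc _ ≤ f.roots.toFinset.card := Finset.card_image_le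
    _ ≤ Multiset.card f.roots := Multiset.toFinset_card_le _
    _ ≤ f.natDegree := Polynomial.card_roots' f
    _ = 3 := hdeg

end Averaging

/-- a line `L` of `PG(5,q)` meeting the secant variety of the Veronese surface in
`r` points has an associated web with exactly `q^2 + rq + 1` singular conics, hence
`q^3 + (1 - r)q` nonsingular conics; moreover `r ∈ {0, 1, 2, 3, q+1}`. -/
theorem web_singular_count_eq_secant_intersection (F : Type) [Field F] [Fintype F] (q : ℕ)
    (hq : Fintype.card F = q) (L : Submodule F (Fin 6 → F)) (hL : Module.finrank F L = 2)
    (r : ℕ)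
    (hr : r = Set.ncard {P : Submodule F (Fin 6 → F) |
      ∃ y : Fin 6 → F, y ≠ 0 ∧ y ∈ L ∧ (M y).rank ≤ 2 ∧ P = Submodule.span F {y}}) :
    r ∈ ({0, 1, 2, 3, q + 1} : Set ℕ) ∧
    numConics (perp L) (fun a => disc a = 0) = q ^ 2 + r * q + 1 ∧
    (numConics (perp L) IsNonsingular : ℤ) = q ^ 3 + (1 - (r : ℤ)) * q := by
  classical
  have hq1 : 1 < q := hq ▸ Fintype.one_lt_card
  have hqz : (1 : ℤ) < q := by exact_mod_cast hq1
  have hq0 : (q : ℤ) - 1 ≠ 0 := by linarith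
  have hset : {P : Submodule F (Fin 6 → F) |
      ∃ y : Fin 6 → F, y ≠ 0 ∧ y ∈ L ∧ (M y).rank ≤ 2 ∧ P = Submodule.span F {y}} =
      {P : Submodule F (Fin 6 → F) |
      ∃ y : Fin 6 → F, y ≠ 0 ∧ (y ∈ L ∧ dm y = 0) ∧ P = Submodule.span F {y}} := by
    simp only [rank_le_two_iff, and_assoc]
  rw [hset] at hr
  have hcr := proj_count (F := F) (fun y => y ∈ L ∧ dm y = 0) (fun c a _ h =>
    ⟨L.smul_mem c h.1, by rw [dm_smul, h.2, mul_zero]⟩)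
  rw [← hr] at hcr
  have hcr1 := card_with_zero (F := F) (fun y => y ∈ L ∧ dm y = 0) ⟨L.zero_mem, by simp [dm]⟩
  rw [hcr] at hcr1
  have hsing := card_sing L hL r hcr1
  have hcs := proj_count (F := F) (fun y => y ∈ perp L ∧ disc y = 0) (fun c a _ h =>
    ⟨(perp L).smul_mem c h.1, by rw [disc_smul, h.2, mul_zero]⟩)
  have hcs1 := card_with_zero (F := F) (fun y => y ∈ perp L ∧ disc y = 0)
    ⟨(perp L).zero_mem, by simp [disc]⟩
  have hcn := proj_count (F := F) (fun y => y ∈ perp L ∧ disc y ≠ 0) (fun c a hc h =>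
    ⟨(perp L).smul_mem c h.1, by rw [disc_smul]; exact mul_ne_zero (pow_ne_zero 3 hc) h.2⟩)
  have hN1 : numConics (perp L) (fun a => disc a = 0) = Set.ncard {P : Submodule F (Fin 6 → F) |
      ∃ y : Fin 6 → F, y ≠ 0 ∧ (y ∈ perp L ∧ disc y = 0) ∧ P = Submodule.span F {y}} := by
    simp only [numConics, and_assoc]
  have hN2 : numConics (perp L) IsNonsingular = Set.ncard {P : Submodule F (Fin 6 → F) |
      ∃ y : Fin 6 → F, y ≠ 0 ∧ (y ∈ perp L ∧ disc y ≠ 0) ∧ P = Submodule.span F {y}} := by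
    simp only [numConics, IsNonsingular, and_assoc]
  rw [← hN1] at hcs
  rw [← hN2] at hcn
  rw [hcs] at hcs1
  have hcomm : Finset.card {a : Fin 6 → F | disc a = 0 ∧ a ∈ perp L}
      = Finset.card {a : Fin 6 → F | a ∈ perp L ∧ disc a = 0} := by
    simp only [and_comm]
  rw [hcomm, hcs1, hq] at hsing
  have hne : Finset.card {a : Fin 6 → F | a ≠ 0 ∧ a ∈ perp L ∧ disc a ≠ 0}
      = Finset.card {a : Fin 6 → F | a ∈ perp L ∧ disc a ≠ 0} := by
    congr 1
    ext a
    simp only [Finset.mem_filter, Finset.mem_univ, true_and]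
    refine ⟨fun h => h.2, fun h => ⟨?_, h⟩⟩
    rintro rfl
    exact h.2 (by simp [disc])
  have hsplit : Finset.card {a : Fin 6 → F | a ∈ perp L ∧ disc a = 0}
      + Finset.card {a : Fin 6 → F | a ∈ perp L ∧ disc a ≠ 0} = q ^ 4 := by
    rw [← hq, ← card_perp L hL, ← Finset.filter_filter, ← Finset.filter_filter]
    exact Finset.card_filter_add_card_filter_not _
  rw [hcs1, ← hne, hcn, hq] at hsplit
  have hsub : ((q - 1 : ℕ) : ℤ) = (q : ℤ) - 1 := by push_cast [Nat.cast_sub hq1.le]; ring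
  have hsz := congrArg (Nat.cast : ℕ → ℤ) hsplit
  push_cast [hsub] at hsz hsing
  have hA : (numConics (perp L) (fun a => disc a = 0) : ℤ) = q ^ 2 + r * q + 1 := by
    apply mul_right_cancel₀ hq0
    linear_combination hsing
  refine ⟨?_, by exact_mod_cast hA, ?_⟩
  · by_cases hall : ∀ y ∈ L, dm y = 0
    · have hLc : Finset.card {y : Fin 6 → F | y ∈ L ∧ dm y = 0} = q ^ 2 := by
        rw [← hq, ← hL, ← Module.card_eq_pow_finrank (K := F) (V := L), Fintype.card_subtype]
        congr 1
        ext y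
        simp only [Finset.mem_filter, Finset.mem_univ, true_and]
        exact ⟨fun h => h.1, fun h => ⟨h, hall y h⟩⟩
      rw [hLc, hq] at hcr1
      have hz := congrArg (Nat.cast : ℕ → ℤ) hcr1
      push_cast [hsub] at hz
      have : (r : ℤ) = q + 1 := by
        apply mul_right_cancel₀ hq0
        linear_combination -hz
      have : r = q + 1 := by exact_mod_cast this
      simp [this]
    · push Not at hall
      obtain ⟨u, hu, hd⟩ := hall
      have h3 := r_le_three L hL u hu hd
      rw [← hr] at h3
      interval_cases r <;> simp
  · apply mul_right_cancel₀ hq0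
    linear_combination hsz - ((q : ℤ) - 1) * hA

end Conics
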